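/- arXiv:math/0306362 — 2 statements merged into one kernel-verified Lean document; each statement's English description precedes it below -/
import Mathlib

section
/- For every 2-form α on ℝ⁷ one has ⋆(⋆(α∧ω)∧ω) = 2α − ⋆(α∧ω); equivalently, the operator L(α) = ⋆(α∧ω) on 2-forms satisfies (L + 2)(L − 1) = 0. -/
open scoped BigOperators

/-- The generalized Kronecker/Levi-Civita epsilon symbol on `Fin 7`. -/
noncomputable def eps (v : Fin 7 → Fin 7) : ℝ :=
  if h : Function.Bijective v then ((Equiv.Perm.sign (Equiv.ofBijective v h) : ℤ) : ℝ) else 0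

/-- The basis monomial form `e_{I 0} ∧ ⋯ ∧ e_{I (p-1)}`, given by its components. -/
noncomputable def mono {p : ℕ} (I : Fin p → Fin 7) : (Fin p → Fin 7) → ℝ :=
  fun v => Matrix.det (Matrix.of fun a b => if I a = v b then (1 : ℝ) else 0)

/-- A (componentwise) `p`-form: totally antisymmetric in its indices. -/
def IsForm {p : ℕ} (c : (Fin p → Fin 7) → ℝ) : Prop :=
  (∀ v : Fin p → Fin 7, ¬ Function.Injective v → c v = 0) ∧
  (∀ (v : Fin p → Fin 7) (σ : Equiv.Perm (Fin p)),
    c (v ∘ σ) = ((Equiv.Perm.sign σ : ℤ) : ℝ) * c v)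

/-- Wedge product of forms, in components. -/
noncomputable def wedge {p q : ℕ} (a : (Fin p → Fin 7) → ℝ) (b : (Fin q → Fin 7) → ℝ) :
    (Fin (p + q) → Fin 7) → ℝ := fun v =>
  (1 / ((Nat.factorial p : ℝ) * (Nat.factorial q : ℝ))) *
    ∑ σ : Equiv.Perm (Fin (p + q)),
      ((Equiv.Perm.sign σ : ℤ) : ℝ) *
        a (fun i => v (σ (Fin.castAdd q i))) * b (fun j => v (σ (Fin.natAdd p j)))

/-- The Hodge star operator (standard metric and orientation on ℝ⁷), in components. -/
noncomputable def hstar {p q : ℕ} (h : p + q = 7) (a : (Fin p → Fin 7) → ℝ) :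
    (Fin q → Fin 7) → ℝ := fun w =>
  (1 / (Nat.factorial p : ℝ)) *
    ∑ v : Fin p → Fin 7, a v * eps (fun i => Fin.append v w (Fin.cast h.symm i))

/-- The fundamental 3-form ω = e₁₂₄+e₂₃₅+e₃₄₆+e₄₅₇+e₅₆₁+e₆₇₂+e₇₁₃ (indices shifted to 0,…,6). -/
noncomputable def ω : (Fin 3 → Fin 7) → ℝ :=
  mono ![0, 1, 3] + mono ![1, 2, 4] + mono ![2, 3, 5] + mono ![3, 4, 6] +
    mono ![4, 5, 0] + mono ![5, 6, 1] + mono ![6, 0, 2]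

/-- The 4-form Φ = −e₃₅₆₇−e₄₆₇₁−e₅₇₁₂−e₆₁₂₃−e₇₂₃₄−e₁₃₄₅−e₂₄₅₆ (indices shifted to 0,…,6). -/
noncomputable def Φ : (Fin 4 → Fin 7) → ℝ :=
  -mono ![2, 4, 5, 6] - mono ![3, 5, 6, 0] - mono ![4, 6, 0, 1] - mono ![5, 0, 1, 2] -
    mono ![6, 1, 2, 3] - mono ![0, 2, 3, 4] - mono ![1, 3, 4, 5]

/-- Components ω_{ijk}. -/
noncomputable def ω3 (i j k : Fin 7) : ℝ := ω ![i, j, k]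

/-- Components ω_{ijkl} = Φ(e_i,e_j,e_k,e_l). -/
noncomputable def ω4 (i j k l : Fin 7) : ℝ := Φ ![i, j, k, l]

/-- Kronecker delta. -/
def δ (i j : Fin 7) : ℝ := if i = j then 1 else 0

/-- Components of a 2-form. -/
def c2 (a : (Fin 2 → Fin 7) → ℝ) (i j : Fin 7) : ℝ := a ![i, j]

/-- The operator α ↦ ⋆(α ∧ ω) on 2-forms. -/
noncomputable def Lω (a : (Fin 2 → Fin 7) → ℝ) : (Fin 2 → Fin 7) → ℝ :=
  hstar (p := 5) (q := 2) rfl (wedge a ω)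

/-- A product formula for `eps`, with integer values. -/
def intEps (v : Fin 7 → Fin 7) : ℤ :=
  ∏ i, ∏ j ∈ Finset.Ioi i, Int.sign ((v j : ℕ) - (v i : ℕ) : ℤ)

theorem eps_eq_intEps (v : Fin 7 → Fin 7) : eps v = intEps v := by
  unfold eps intEps
  split_ifs with h
  · rw [Equiv.Perm.sign_eq_prod_prod_Ioi]
    push_cast
    refine Finset.prod_congr rfl fun i _ => Finset.prod_congr rfl fun j hj => ?_
    have hne : v i ≠ v j := h.injective.ne (Finset.mem_Ioi.1 hj).ne
    simp only [Equiv.ofBijective_apply]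
    split_ifs with hlt
    · rw [Int.sign_eq_one_of_pos (by simpa using hlt)]
      simp
    · have : v j < v i := lt_of_le_of_ne (not_lt.1 hlt) hne.symm
      rw [Int.sign_eq_neg_one_of_neg (by simpa using this)]
      simp
  · have hinj : ¬ Function.Injective v := fun hv => h (Finite.injective_iff_bijective.1 hv)
    obtain ⟨i, j, hv, hne⟩ := Function.not_injective_iff.1 hinj
    wlog hij : i < j generalizing i j
    · exact this j i hv.symm hne.symm (lt_of_le_of_ne (not_lt.1 hij) hne.symm)
    rw [Finset.prod_eq_zero (Finset.mem_univ i)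
      (Finset.prod_eq_zero (Finset.mem_Ioi.2 hij) (by simp [hv]))]
    simp

theorem eps_perm (τ : Equiv.Perm (Fin 7)) : eps τ = ((Equiv.Perm.sign τ : ℤ) : ℝ) := by
  rw [eps, dif_pos τ.bijective, Equiv.ofBijective_coe]

theorem eps_comp (f v : Fin 7 → Fin 7) : eps (f ∘ v) = eps f * eps v := by
  by_cases hv : Function.Bijective v
  · by_cases hf : Function.Bijective f
    · rw [eps, eps, eps, dif_pos hf, dif_pos hv, dif_pos (hf.comp hv),
        show Equiv.ofBijective (f ∘ v) (hf.comp hv) =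
          Equiv.ofBijective f hf * Equiv.ofBijective v hv from Equiv.ext fun _ => rfl,
        Equiv.Perm.sign_mul]
      push_cast
      rfl
    · have hfv : ¬ Function.Bijective (f ∘ v) := fun h => hf ((hv.of_comp_iff f).1 h)
      rw [eps, eps, dif_neg hf, dif_neg hfv, zero_mul]
  · have hfv : ¬ Function.Bijective (f ∘ v) := fun h =>
      hv (Finite.injective_iff_bijective.1 h.injective.of_comp)
    rw [eps, eps, eps, dif_neg hv, dif_neg hfv, mul_zero]

theorem eps_comp_perm (v : Fin 7 → Fin 7) (τ : Equiv.Perm (Fin 7)) :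
    eps (v ∘ τ) = ((Equiv.Perm.sign τ : ℤ) : ℝ) * eps v := by
  rw [eps_comp, eps_perm, mul_comm]

theorem eps_affine {d : Fin 7} (hd : d = 1 ∨ d = 2 ∨ d = 4) (t : Fin 7) :
    eps (fun n => t + d * n) = 1 := by
  have h : ∀ d : Fin 7, d = 1 ∨ d = 2 ∨ d = 4 → ∀ t : Fin 7,
      intEps (fun n => t + d * n) = 1 := by decide +kernel
  rw [eps_eq_intEps, h d hd t, Int.cast_one]

/-- Permuting the block of arguments of `eps` selected by an embedding multiplies it by the sign. -/
theorem eps_block_perm {p : ℕ} (e : Fin p ↪ Fin 7) (σ : Equiv.Perm (Fin p))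
    {u v : Fin 7 → Fin 7} (hblock : ∀ i, u (e i) = v (e (σ i)))
    (hrest : ∀ j, j ∉ Set.range e → u j = v j) :
    eps u = ((Equiv.Perm.sign σ : ℤ) : ℝ) * eps v := by
  rw [← Equiv.Perm.viaFintypeEmbedding_sign σ e, ← eps_comp_perm]
  congr 1
  funext j
  by_cases hj : j ∈ Set.range e
  · obtain ⟨i, rfl⟩ := hj
    simp [hblock]
  · simp [Equiv.Perm.viaFintypeEmbedding_apply_notMem_range _ _ hj, hrest j hj]

theorem eps_append_comp_perm {p r : ℕ} (h : p + r = 7) (v : Fin p → Fin 7) (w : Fin r → Fin 7)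
    (σ : Equiv.Perm (Fin p)) :
    eps (fun i => Fin.append (v ∘ σ) w (Fin.cast h.symm i)) =
      ((Equiv.Perm.sign σ : ℤ) : ℝ) * eps (fun i => Fin.append v w (Fin.cast h.symm i)) := by
  refine eps_block_perm ((Fin.castAddEmb r).trans (finCongr h).toEmbedding) σ
    (fun i => by simp) fun j hj => ?_
  obtain ⟨k, rfl⟩ := (finCongr h).surjective j
  induction k using Fin.addCases with
  | left i => exact absurd ⟨i, rfl⟩ hj
  | right i => simp

theorem eps_append_append_comp_perm {p q r : ℕ} (h : p + q + r = 7) (x : Fin p → Fin 7)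
    (y : Fin q → Fin 7) (w : Fin r → Fin 7) (σ : Equiv.Perm (Fin q)) :
    eps (fun i => Fin.append (Fin.append x (y ∘ σ)) w (Fin.cast h.symm i)) =
      ((Equiv.Perm.sign σ : ℤ) : ℝ) *
        eps (fun i => Fin.append (Fin.append x y) w (Fin.cast h.symm i)) := by
  refine eps_block_perm ((Fin.natAddEmb p).trans
    ((Fin.castAddEmb r).trans (finCongr h).toEmbedding)) σ
    (fun i => by simp) fun j hj => ?_
  obtain ⟨k, rfl⟩ := (finCongr h).surjective j
  induction k using Fin.addCases with
  | left i =>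
    induction i using Fin.addCases with
    | left i => simp
    | right i => exact absurd ⟨i, rfl⟩ hj
  | right i => simp

theorem hstar_wedge {p q r : ℕ} (h : p + q + r = 7) (a : (Fin p → Fin 7) → ℝ)
    (b : (Fin q → Fin 7) → ℝ) (w : Fin r → Fin 7) :
    hstar h (wedge a b) w = 1 / ((p.factorial : ℝ) * q.factorial) *
      ∑ x : Fin p → Fin 7, ∑ y : Fin q → Fin 7, a x * b y *
        eps (fun i => Fin.append (Fin.append x y) w (Fin.cast h.symm i)) := by
  have hσ (σ : Equiv.Perm (Fin (p + q))) :
      ∑ v : Fin (p + q) → Fin 7, ((Equiv.Perm.sign σ : ℤ) : ℝ) *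
          a (fun i => v (σ (Fin.castAdd q i))) * b (fun j => v (σ (Fin.natAdd p j))) *
          eps (fun i => Fin.append v w (Fin.cast h.symm i)) =
        ∑ x : Fin p → Fin 7, ∑ y : Fin q → Fin 7, a x * b y *
          eps (fun i => Fin.append (Fin.append x y) w (Fin.cast h.symm i)) := by
    rw [← Fintype.sum_prod_type', ← (Fin.appendEquiv p q).symm.sum_comp]
    refine Eq.trans (Finset.sum_congr rfl fun v _ => ?_)
      (Equiv.sum_comp (Equiv.arrowCongr σ.symm (Equiv.refl (Fin 7))) _)
    have hv : Fin.append (fun i => v (σ (Fin.castAdd q i))) (fun j => v (σ (Fin.natAdd p j))) =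
        v ∘ σ := Fin.append_castAdd_natAdd (f := v ∘ σ)
    simp only [Fin.appendEquiv, Equiv.coe_fn_symm_mk, Equiv.arrowCongr_apply, Equiv.coe_refl,
      Equiv.symm_symm, Function.comp_apply, id_eq]
    rw [hv, eps_append_comp_perm h]
    ring
  unfold hstar wedge
  simp only [mul_assoc (1 / _ : ℝ), ← Finset.mul_sum, Finset.sum_mul]
  rw [Finset.sum_comm, Finset.sum_congr rfl fun σ _ => hσ σ, Finset.sum_const,
    Finset.card_univ, Fintype.card_perm, Fintype.card_fin, nsmul_eq_mul]
  have : ((p + q).factorial : ℝ) ≠ 0 := by positivity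
  field_simp

theorem sum_mono_mul {q : ℕ} (I : Fin q → Fin 7) (F : (Fin q → Fin 7) → ℝ)
    (hF : ∀ σ : Equiv.Perm (Fin q), F (I ∘ σ) = ((Equiv.Perm.sign σ : ℤ) : ℝ) * F I) :
    ∑ v, mono I v * F v = q.factorial * F I := by
  have hmono (v : Fin q → Fin 7) : mono I v =
      ∑ σ : Equiv.Perm (Fin q), ((Equiv.Perm.sign σ : ℤ) : ℝ) * if I ∘ σ = v then 1 else 0 := by
    simp [mono, Matrix.det_apply', Finset.prod_ite_zero, funext_iff]
  have hsign (σ : Equiv.Perm (Fin q)) :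
      ((Equiv.Perm.sign σ : ℤ) : ℝ) * ((Equiv.Perm.sign σ : ℤ) : ℝ) = 1 := by
    exact_mod_cast Int.units_coe_mul_self _
  simp only [hmono, Finset.sum_mul]
  rw [Finset.sum_comm]
  simp [hF, ← mul_assoc, hsign, Fintype.card_perm]

theorem mono_comp_perm {p : ℕ} (I : Fin p → Fin 7) (σ : Equiv.Perm (Fin p)) :
    mono (I ∘ σ) = ((Equiv.Perm.sign σ : ℤ) : ℝ) • mono I :=
  funext fun v => Matrix.det_permute σ (Matrix.of fun a b => if I a = v b then (1 : ℝ) else 0)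

theorem mono_rotate (i j k : Fin 7) : mono ![i, j, k] = mono ![k, i, j] := by
  have h := mono_comp_perm ![k, i, j] (finRotate 3)
  have hc : ![k, i, j] ∘ finRotate 3 = ![i, j, k] := by
    funext n
    fin_cases n <;> rfl
  rw [hc, sign_finRotate] at h
  simpa using h

theorem ω_eq_sum {d : Fin 7} (hd : d = 1 ∨ d = 2 ∨ d = 4) :
    ω = ∑ m : Fin 7, mono ![m, m + d, m + 3 * d] := by
  have h₁ : ω = ∑ m : Fin 7, mono ![m, m + 1, m + 3] := by
    simp only [Fin.sum_univ_seven]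
    rfl
  have hmod : ∀ m : Fin 7, (m + 6 + 1 = m ∧ m + 6 + 3 = m + 2 ∧ m + 3 * 2 = m + 6) ∧
      m + 4 + 1 = m + 3 * 4 ∧ m + 4 + 3 = m := by decide
  rcases hd with rfl | rfl | rfl
  · exact h₁
  · rw [h₁, ← Equiv.sum_comp (Equiv.addRight (6 : Fin 7))]
    refine Finset.sum_congr rfl fun m _ => ?_
    obtain ⟨⟨e₁, e₂, e₃⟩, -⟩ := hmod m
    rw [Equiv.coe_addRight, e₁, e₂, e₃, ← mono_rotate]
  · rw [h₁, ← Equiv.sum_comp (Equiv.addRight (4 : Fin 7))]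
    refine Finset.sum_congr rfl fun m _ => ?_
    obtain ⟨-, e₁, e₂⟩ := hmod m
    rw [Equiv.coe_addRight, e₁, e₂, mono_rotate]

theorem Lω_apply (a : (Fin 2 → Fin 7) → ℝ) {d : Fin 7} (hd : d = 1 ∨ d = 2 ∨ d = 4)
    (k l : Fin 7) :
    Lω a ![k, l] = 1 / 2 * ∑ i, ∑ j, a ![i, j] *
      ∑ m : Fin 7, eps ![i, j, m, m + d, m + 3 * d, k, l] := by
  have happ (i j m : Fin 7) :
      (fun n => Fin.append (Fin.append ![i, j] ![m, m + d, m + 3 * d]) ![k, l]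
        (Fin.cast rfl n)) = ![i, j, m, m + d, m + 3 * d, k, l] := by
    funext n
    fin_cases n <;> rfl
  have hsum (x : Fin 2 → Fin 7) : ∑ y : Fin 3 → Fin 7, a x * ω y *
      eps (fun n => Fin.append (Fin.append x y) ![k, l] (Fin.cast rfl n)) =
      6 * (a x * ∑ m : Fin 7, eps (fun n =>
        Fin.append (Fin.append x ![m, m + d, m + 3 * d]) ![k, l] (Fin.cast rfl n))) := by
    simp only [mul_assoc, ← Finset.mul_sum]
    rw [mul_left_comm]
    congr 1
    simp only [ω_eq_sum hd, Finset.sum_apply, Finset.sum_mul]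
    rw [Finset.sum_comm, Finset.mul_sum]
    refine Finset.sum_congr rfl fun m _ => ?_
    have h := sum_mono_mul ![m, m + d, m + 3 * d] (fun y => eps fun n : Fin 7 =>
      Fin.append (Fin.append x y) ![k, l] (Fin.cast rfl n))
      fun σ => eps_append_append_comp_perm rfl x _ ![k, l] σ
    rw [h]
    norm_num [Nat.factorial]
  rw [Lω, hstar_wedge (p := 2) (q := 3) rfl, Finset.sum_congr rfl fun x _ => hsum x,
    ← (finTwoArrowEquiv (Fin 7)).symm.sum_comp, Fintype.sum_prod_type]
  simp only [finTwoArrowEquiv_symm_apply, happ, ← Finset.mul_sum]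
  norm_num [Nat.factorial]
  ring

theorem sum_intEps_line : ∀ i j : Fin 7,
    ∑ m : Fin 7, intEps ![i, j, m, m + 1, m + 3, 0, 1] =
      ((if i = 2 then if j = 5 then 1 else 0 else 0) -
        (if i = 5 then if j = 2 then 1 else 0 else 0)) -
      ((if i = 4 then if j = 6 then 1 else 0 else 0) -
        (if i = 6 then if j = 4 then 1 else 0 else 0)) := by
  decide +kernel

theorem IsForm.swap {a : (Fin 2 → Fin 7) → ℝ} (ha : IsForm a) (i j : Fin 7) :
    a ![j, i] = -a ![i, j] := by
  have h := ha.2 ![i, j] (Equiv.swap 0 1)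
  have hc : ![i, j] ∘ (Equiv.swap 0 1 : Equiv.Perm (Fin 2)) = ![j, i] := by
    funext n
    fin_cases n <;> rfl
  rw [hc, Equiv.Perm.sign_swap (by decide)] at h
  simpa using h

theorem Lω_swap (a : (Fin 2 → Fin 7) → ℝ) (k l : Fin 7) : Lω a ![l, k] = -Lω a ![k, l] := by
  have hε (i j m : Fin 7) : eps ![i, j, m, m + 1, m + 3 * 1, l, k] =
      -eps ![i, j, m, m + 1, m + 3 * 1, k, l] := by
    have h := eps_comp_perm ![i, j, m, m + 1, m + 3 * 1, k, l] (Equiv.swap 5 6)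
    have hc : ![i, j, m, m + 1, m + 3 * 1, k, l] ∘ (Equiv.swap 5 6 : Equiv.Perm (Fin 7)) =
        ![i, j, m, m + 1, m + 3 * 1, l, k] := by
      funext n
      fin_cases n <;> rfl
    rw [hc, Equiv.Perm.sign_swap (by decide)] at h
    simpa using h
  simp only [Lω_apply a (Or.inl rfl), hε, Finset.sum_neg_distrib, mul_neg]

theorem Lω_line {a : (Fin 2 → Fin 7) → ℝ} (ha : ∀ i j, a ![j, i] = -a ![i, j])
    {d : Fin 7} (hd : d = 1 ∨ d = 2 ∨ d = 4) (t : Fin 7) :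
    Lω a ![t, t + d] = a ![t + 2 * d, t + 5 * d] - a ![t + 4 * d, t + 6 * d] := by
  have hd_bij : ∀ d : Fin 7, d = 1 ∨ d = 2 ∨ d = 4 → ∀ t : Fin 7,
      Function.Bijective fun n => t + d * n := by decide
  have hmod : ∀ t d m : Fin 7, t + d * (m + 1) = t + d * m + d ∧
      t + d * (m + 3) = t + d * m + 3 * d := by decide
  have hcoord : ∀ t d : Fin 7, t + d * 0 = t ∧ t + d * 1 = t + d ∧ t + d * 2 = t + 2 * d ∧
      t + d * 4 = t + 4 * d ∧ t + d * 5 = t + 5 * d ∧ t + d * 6 = t + 6 * d := by decide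
  obtain ⟨h₀, h₁, h₂, h₄, h₅, h₆⟩ := hcoord t d
  let τ := Equiv.ofBijective _ (hd_bij d hd t)
  have hτ (n : Fin 7) : τ n = t + d * n := rfl
  have hε (i j m : Fin 7) : eps ![τ i, τ j, τ m, τ m + d, τ m + 3 * d, t, t + d] =
      intEps ![i, j, m, m + 1, m + 3, 0, 1] := by
    have h := eps_comp (fun n => t + d * n) ![i, j, m, m + 1, m + 3, 0, 1]
    rw [eps_affine hd, one_mul] at h
    rw [← eps_eq_intEps, ← h]
    congr 1
    funext n
    fin_cases n
    exacts [rfl, rfl, rfl, (hmod t d m).1.symm, (hmod t d m).2.symm, h₀.symm, h₁.symm]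
  have hsum (i j : Fin 7) :
      ∑ m : Fin 7, eps ![τ i, τ j, m, m + d, m + 3 * d, t, t + d] =
        ((∑ m : Fin 7, intEps ![i, j, m, m + 1, m + 3, 0, 1] : ℤ) : ℝ) := by
    rw [← τ.sum_comp, Int.cast_sum]
    exact Finset.sum_congr rfl fun m _ => hε i j m
  rw [Lω_apply a hd, ← τ.sum_comp]
  simp only [← τ.sum_comp fun j => a ![_, j] * _, hsum, sum_intEps_line]
  push_cast
  simp only [mul_sub, Finset.sum_sub_distrib, mul_ite, mul_one, mul_zero, Finset.sum_ite_eq',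
    Finset.sum_ite_irrel, Finset.sum_const_zero, Finset.mem_univ, if_true, hτ, h₂, h₄, h₅, h₆]
  rw [ha (t + 2 * d) (t + 5 * d), ha (t + 4 * d) (t + 6 * d)]
  ring

theorem Lω_Lω_line {a : (Fin 2 → Fin 7) → ℝ} (ha : ∀ i j, a ![j, i] = -a ![i, j])
    {d : Fin 7} (hd : d = 1 ∨ d = 2 ∨ d = 4) (t : Fin 7) :
    Lω (Lω a) ![t, t + d] = 2 * a ![t, t + d] - Lω a ![t, t + d] := by
  have hdbl : ∀ d : Fin 7, d = 1 ∨ d = 2 ∨ d = 4 →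
      (2 * d = 1 ∨ 2 * d = 2 ∨ 2 * d = 4) ∧ (4 * d = 1 ∨ 4 * d = 2 ∨ 4 * d = 4) := by decide
  have hLa := Lω_line ha hd t
  have h₂ := Lω_line ha (hdbl d hd).1 (t + 4 * d)
  have h₄ := Lω_line ha (hdbl d hd).2 (t + 5 * d)
  have hmod : ∀ t d : Fin 7,
      (t + 4 * d + 2 * d = t + 6 * d ∧ t + 4 * d + 2 * (2 * d) = t + d ∧
        t + 4 * d + 5 * (2 * d) = t ∧ t + 4 * d + 4 * (2 * d) = t + 5 * d ∧
        t + 4 * d + 6 * (2 * d) = t + 2 * d) ∧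
      (t + 5 * d + 4 * d = t + 2 * d ∧ t + 5 * d + 2 * (4 * d) = t + 6 * d ∧
        t + 5 * d + 5 * (4 * d) = t + 4 * d ∧ t + 5 * d + 4 * (4 * d) = t ∧
        t + 5 * d + 6 * (4 * d) = t + d) := by decide
  obtain ⟨⟨e₁, e₂, e₃, e₄, e₅⟩, f₁, f₂, f₃, f₄, f₅⟩ := hmod t d
  rw [e₁, e₂, e₃, e₄, e₅] at h₂
  rw [f₁, f₂, f₃, f₄, f₅] at h₄
  rw [Lω_line (fun i j => Lω_swap a i j) hd, Lω_swap a (t + 5 * d), h₂, h₄, hLa,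
    ha t (t + d), ha (t + 2 * d), ha (t + 4 * d) (t + 6 * d)]
  ring

/-- the operator L(α) = ⋆(α∧ω) on 2-forms satisfies L² = 2 − L,
i.e. (L + 2)(L − 1) = 0. -/
theorem Lomega_quadratic (a : (Fin 2 → Fin 7) → ℝ) (ha : IsForm a) :
    Lω (Lω a) = (2 : ℝ) • a - Lω a := by
  have hpairs : ∀ i j : Fin 7, ∃ t d : Fin 7, (d = 1 ∨ d = 2 ∨ d = 4) ∧
      (i = j ∨ (i = t ∧ j = t + d) ∨ (i = t + d ∧ j = t)) := by decide
  have hself {c : (Fin 2 → Fin 7) → ℝ} (hc : ∀ i j, c ![j, i] = -c ![i, j]) (i : Fin 7) :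
      c ![i, i] = 0 := by linarith [hc i i]
  funext w
  obtain ⟨t, d, hd, h⟩ := hpairs (w 0) (w 1)
  rw [show w = ![w 0, w 1] from List.ofFn_inj.1 rfl]
  simp only [Pi.sub_apply, Pi.smul_apply, smul_eq_mul]
  rcases h with h | ⟨h₀, h₁⟩ | ⟨h₀, h₁⟩
  · rw [h, hself ha.swap, hself (Lω_swap a), hself (Lω_swap (Lω a))]
    ring
  · rw [h₀, h₁, Lω_Lω_line ha.swap hd]
  · rw [h₀, h₁, Lω_swap (Lω a), Lω_swap a, ha.swap, Lω_Lω_line ha.swap hd]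
    ring
end

section
/- Let R : (ℝ⁷)⁴ → ℝ be an algebraic curvature tensor, i.e. R_{ijkl} = −R_{jikl} = −R_{ijlk}, R_{ijkl} = R_{klij}, and R_{ijkl} + R_{iklj} + R_{iljk} = 0 (first Bianchi identity). Define the Ricci tensor ρ_{ij} = R_{sijs}, the scalar curvature s = ρ_{ii}, the ⋆-Ricci tensor ρ⋆_{sm} = R_{ijkl}ω_{ijs}ω_{klm}, and the ⋆-scalar curvature s⋆ = ρ⋆_{mm}. Then s⋆ = −2s. -/
open scoped BigOperators

/-- The determinant giving the components of `e_a ∧ e_b ∧ e_c`, with integer values. -/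
def monoInt (a b c i j k : Fin 7) : ℤ :=
  let d := fun x y : Fin 7 => if x = y then (1 : ℤ) else 0
  d a i * d b j * d c k - d a i * d b k * d c j - d a j * d b i * d c k +
    d a j * d b k * d c i + d a k * d b i * d c j - d a k * d b j * d c i

/-- The components of the fundamental 3-form, as integers depending only on index differences. -/
def omegaInt (i j k : Fin 7) : ℤ :=
  match j - i, k - i with
  | 1, 3 | 2, 6 | 4, 5 => 1
  | 3, 1 | 6, 2 | 5, 4 => -1
  | _, _ => 0

/-- The contraction `ω_{ijm} ω_{klm}`, without its curvature-like part. -/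
def contractionInt (i j k l : Fin 7) : ℤ :=
  ∑ m, omegaInt i j m * omegaInt k l m -
    ((if i = k ∧ j = l then 1 else 0) - (if i = l ∧ j = k then 1 else 0))

theorem sum_monoInt_eq_omegaInt : ∀ i j k : Fin 7,
    monoInt 0 1 3 i j k + monoInt 1 2 4 i j k + monoInt 2 3 5 i j k + monoInt 3 4 6 i j k +
      monoInt 4 5 0 i j k + monoInt 5 6 1 i j k + monoInt 6 0 2 i j k = omegaInt i j k := by
  decide +kernel

theorem contractionInt_cyclic : ∀ i j k l : Fin 7,
    contractionInt i k l j = contractionInt i j k l := by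
  decide +kernel

theorem mono_three_eq_monoInt (a b c i j k : Fin 7) :
    mono ![a, b, c] ![i, j, k] = (monoInt a b c i j k : ℝ) := by
  simp [mono, monoInt, Matrix.det_fin_three, -mul_ite, -ite_mul]
  rfl

theorem ω3_eq_omegaInt (i j k : Fin 7) : ω3 i j k = (omegaInt i j k : ℝ) := by
  simp only [ω3, ω, Pi.add_apply, mono_three_eq_monoInt, ← sum_monoInt_eq_omegaInt]
  push_cast
  rfl

theorem sum_ω3_mul_ω3 (i j k l : Fin 7) :
    ∑ m, ω3 i j m * ω3 k l m =
      (if i = k ∧ j = l then 1 else 0) - (if i = l ∧ j = k then 1 else 0) +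
        (contractionInt i j k l : ℝ) := by
  simp [ω3_eq_omegaInt, contractionInt]

/-- By the first Bianchi identity, the contraction with a cyclically symmetric tensor vanishes. -/
theorem sum_mul_eq_zero_of_bianchi {ι : Type*} [Fintype ι] (R P : ι → ι → ι → ι → ℝ)
    (hR : ∀ i j k l, R i j k l + R i k l j + R i l j k = 0)
    (hP : ∀ i j k l, P i k l j = P i j k l) :
    ∑ i, ∑ j, ∑ k, ∑ l, R i j k l * P i j k l = 0 := by
  refine Finset.sum_eq_zero fun i _ => ?_
  have rotate (f : ι → ι → ι → ℝ) :
      ∑ j, ∑ k, ∑ l, f k l j = ∑ j, ∑ k, ∑ l, f j k l := by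
    rw [Finset.sum_comm]
    exact Finset.sum_congr rfl fun k _ => Finset.sum_comm
  have h₁ := rotate fun j k l => R i j k l * P i j k l
  have h₂ := rotate fun j k l => R i k l j * P i k l j
  have h : ∑ j, ∑ k, ∑ l, (R i j k l * P i j k l + R i k l j * P i k l j +
      R i l j k * P i l j k) = 0 := by
    refine Finset.sum_eq_zero fun j _ => Finset.sum_eq_zero fun k _ =>
      Finset.sum_eq_zero fun l _ => ?_
    rw [← hP i l j k, hP i j k l, ← add_mul, ← add_mul, hR, zero_mul]
  simp only [Finset.sum_add_distrib] at h
  linarith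

/-- the ⋆-scalar curvature s⋆ = ρ⋆_{mm}, where ρ⋆_{sm} = R_{ijkl}ω_{ijs}ω_{klm},
equals −2 times the scalar curvature s = ρ_{ii} = R_{sii s}. -/
theorem star_scalar_eq_neg_two_scalar (R : Fin 7 → Fin 7 → Fin 7 → Fin 7 → ℝ)
    (hskew1 : ∀ i j k l, R i j k l = -R j i k l)
    (hskew2 : ∀ i j k l, R i j k l = -R i j l k)
    (hpair : ∀ i j k l, R i j k l = R k l i j)
    (hbianchi : ∀ i j k l, R i j k l + R i k l j + R i l j k = 0) :
    (∑ m : Fin 7, ∑ i : Fin 7, ∑ j : Fin 7, ∑ k : Fin 7, ∑ l : Fin 7,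
        R i j k l * ω3 i j m * ω3 k l m) =
      -2 * ∑ s : Fin 7, ∑ i : Fin 7, R s i i s := by
  have hcontract : (∑ m : Fin 7, ∑ i : Fin 7, ∑ j : Fin 7, ∑ k : Fin 7, ∑ l : Fin 7,
      R i j k l * ω3 i j m * ω3 k l m) =
      ∑ i, ∑ j, ∑ k, ∑ l, R i j k l * ∑ m, ω3 i j m * ω3 k l m := by
    simp only [Finset.mul_sum, ← mul_assoc]
    rw [Finset.sum_comm]
    refine Finset.sum_congr rfl fun i _ => ?_
    rw [Finset.sum_comm]
    refine Finset.sum_congr rfl fun j _ => ?_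
    rw [Finset.sum_comm]
    exact Finset.sum_congr rfl fun k _ => Finset.sum_comm
  have hzero := sum_mul_eq_zero_of_bianchi R (fun i j k l => (contractionInt i j k l : ℝ)) hbianchi
    fun i j k l => by rw [contractionInt_cyclic]
  have hdelta : ∑ i, ∑ j, ∑ k, ∑ l, R i j k l *
      ((if i = k ∧ j = l then (1 : ℝ) else 0) - (if i = l ∧ j = k then 1 else 0)) =
      ∑ i, ∑ j, -2 * R i j j i := by
    refine Finset.sum_congr rfl fun i _ => Finset.sum_congr rfl fun j _ => ?_
    simp only [mul_sub, Finset.sum_sub_distrib, ite_and, mul_ite, mul_one, mul_zero,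
      Finset.sum_ite_eq, Finset.sum_ite_irrel, Finset.sum_const_zero, Finset.mem_univ, if_true]
    rw [hskew2 i j i j]
    ring
  rw [hcontract]
  simp only [sum_ω3_mul_ω3, mul_add _ _ (Int.cast _), Finset.sum_add_distrib, hdelta, hzero,
    add_zero, ← Finset.mul_sum]
end
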